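/- Let F be a field, let n, k ∈ ℕ with n ≥ 2 and k < n − k, and let A ∈ M_n(F) be the block matrix with zero blocks of sizes k×k, k×(n−k), (n−k)×k and with an invertible non-derogatory matrix A₂₂ ∈ M_{n−k}(F) in the lower-right block. If the trace of A is zero, then there exist an n-torsion matrix T ∈ M_n(F) (i.e. Tⁿ = Id_n) and a square-zero matrix N₂ ∈ M_n(F) such that A = T + N₂. -/

import Mathlib

open Matrix Polynomial

/-- The companion matrix with last column `-c`. -/
def compMat (F : Type*) [Field F] (m : ℕ) (c : ℕ → F) : Matrix (Fin m) (Fin m) F :=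
  Matrix.of fun j i => if (i : ℕ) + 1 < m then (if (j : ℕ) = i + 1 then 1 else 0) else - c j

lemma sum_compMat {F : Type*} [Field F] {M : Type*} [AddCommGroup M] [Module F M]
    (m : ℕ) (c : ℕ → F) (w : ℕ → M) (i : Fin m) :
    ∑ j : Fin m, compMat F m c j i • w j =
      if (i : ℕ) + 1 < m then w (i + 1) else - ∑ j ∈ Finset.range m, c j • w j := by
  rw [← Fin.sum_univ_eq_sum_range (fun j => c j • w j)]
  split_ifs with h
  · rw [Finset.sum_eq_single (⟨i + 1, h⟩ : Fin m)]
    · simp [compMat, h]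
    · intro b _ hb
      have : (b : ℕ) ≠ i + 1 := fun h' => hb (Fin.ext h')
      simp [compMat, h, this]
    · simp
  · simp [compMat, h]

lemma exists_cyclic {F : Type*} [Field F] (m : ℕ) (B : Matrix (Fin m) (Fin m) F)
    (h : minpoly F B = B.charpoly) :
    ∃ P : Matrix (Fin m) (Fin m) F, IsUnit P ∧ B * P = P * compMat F m B.charpoly.coeff := by
  obtain ⟨v, hv⟩ : ∃ v : Fin m → F, ∀ f : F[X], (aeval B f) *ᵥ v = 0 → B.charpoly ∣ f := by
    let φ := Matrix.toLin' B
    obtain ⟨x, hx⟩ := Module.exists_ker_toSpanSingleton_eq_annihilator F[X] (Module.AEval' φ)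
    refine ⟨(Module.AEval'.of φ).symm x, fun f hf => ?_⟩
    rw [← h, minpoly.dvd_iff]
    have hB : ∀ y : Fin m → F, Module.AEval'.of φ ((aeval B f) *ᵥ y) = f • Module.AEval'.of φ y := by
      intro y
      have e1 := Module.AEval.of_aeval_smul (a := φ) f y
      have e2 : aeval φ f = Matrix.toLin' (aeval B f) := by
        have := Polynomial.aeval_algHom_apply (Matrix.toLinAlgEquiv' (R := F) (n := Fin m)).toAlgHom B f
        exact this
      rw [e2] at e1
      exact e1
    have h1 : f ∈ Module.annihilator F[X] (Module.AEval' φ) := by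
      rw [← hx, LinearMap.mem_ker, LinearMap.toSpanSingleton_apply]
      have := hB ((Module.AEval'.of φ).symm x)
      rw [hf, map_zero, LinearEquiv.apply_symm_apply] at this
      exact this.symm
    apply Matrix.ext_of_mulVec_single
    intro i
    have h2 := hB (Pi.single i 1)
    rw [Module.mem_annihilator.1 h1, LinearEquiv.map_eq_zero_iff] at h2
    rw [h2, Matrix.zero_mulVec]
  refine ⟨Matrix.of fun i j => (B ^ (j : ℕ) *ᵥ v) i, ?_, ?_⟩
  · rw [← Matrix.mulVec_injective_iff_isUnit, ← Matrix.coe_mulVecLin, ← LinearMap.ker_eq_bot,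
      LinearMap.ker_eq_bot']
    intro y hy
    have h1 : (aeval B (∑ i : Fin m, C (y i) * X ^ (i : ℕ))) *ᵥ v = 0 := by
      rw [← hy, map_sum, Matrix.sum_mulVec]
      ext a
      rw [Finset.sum_apply]
      refine Finset.sum_congr rfl fun i _ => ?_
      rw [map_mul, aeval_C, map_pow, aeval_X, ← Algebra.smul_def, Matrix.smul_mulVec,
        Pi.smul_apply, smul_eq_mul, mul_comm]
      rfl
    have h2 := hv _ h1
    have h3 : (∑ i : Fin m, C (y i) * X ^ (i : ℕ) : F[X]) = 0 := by
      refine Polynomial.eq_zero_of_dvd_of_degree_lt h2 ?_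
      rw [Matrix.charpoly_degree_eq_dim, Fintype.card_fin]
      exact Polynomial.degree_sum_fin_lt y
    ext i
    have h4 := congrArg (fun p => coeff p i) h3
    simpa [Polynomial.finsetSum_coeff, Polynomial.coeff_C_mul, Polynomial.coeff_X_pow, Fin.val_inj] using h4
  · ext a i
    have h1 := congrFun (sum_compMat m B.charpoly.coeff (fun j => B ^ j *ᵥ v) i) a
    rw [Finset.sum_apply] at h1
    have h2 : (B * (Matrix.of fun i j => (B ^ (j : ℕ) *ᵥ v) i : Matrix (Fin m) (Fin m) F)) a i
       = (B ^ ((i : ℕ) + 1) *ᵥ v) a := by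
      rw [pow_succ', ← Matrix.mulVec_mulVec]
      rfl
    rw [h2, Matrix.mul_apply]
    simp only [Pi.smul_apply, smul_eq_mul] at h1
    simp only [Matrix.of_apply, mul_comm _ (compMat _ _ _ _ _)]
    rw [h1]
    split_ifs with hi
    · rfl
    · have him : (i : ℕ) + 1 = m := by omega
      rw [him]
      have h3 := B.aeval_self_charpoly
      have h4 : B.charpoly.natDegree = m := by simp
      have h5 : B.charpoly.coeff m = 1 := by
        have := B.charpoly_monic.coeff_natDegree
        rwa [h4] at this
      rw [aeval_eq_sum_range, h4, Finset.sum_range_succ, h5, one_smul] at h3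
      rw [eq_neg_of_add_eq_zero_right h3]
      rw [Matrix.neg_mulVec, Matrix.sum_mulVec]
      simp [Matrix.smul_mulVec]

lemma pow_eq_one_of_basis {F : Type*} [Field F] {Q : Type*} [CommRing Q] [Algebra F Q]
    {ι : Type*} [Fintype ι] [DecidableEq ι] (b : ι → Q) (hb : LinearIndependent F b)
    (T : Matrix ι ι F) (x : Q) (hT : ∀ i, x * b i = ∑ j, T j i • b j) (n : ℕ) (hx : x ^ n = 1) :
    T ^ n = 1 := by
  have key : ∀ t : ℕ, ∀ i, x ^ t * b i = ∑ j, (T ^ t) j i • b j := by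
    intro t
    induction t with
    | zero => intro i; simp [Matrix.one_apply]
    | succ t ih =>
      intro i
      rw [pow_succ, mul_assoc, hT, Finset.mul_sum]
      simp_rw [mul_smul_comm, ih, Finset.smul_sum, smul_smul, pow_succ, Matrix.mul_apply,
        Finset.sum_smul]
      rw [Finset.sum_comm]
      simp_rw [mul_comm]
  ext j i
  have := key n i
  rw [hx, one_mul] at this
  have h2 : ∑ j, ((T ^ n) j i - (1 : Matrix ι ι F) j i) • b j = 0 := by
    simp only [sub_smul, Finset.sum_sub_distrib, ← this]
    simp [Matrix.one_apply]
  exact sub_eq_zero.1 (Fintype.linearIndependent_iff.1 hb _ h2 j)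

lemma linIndep_of_stable {F : Type*} [Field F] {n : ℕ} (hn : 2 ≤ n)
    {ι : Type*} [Fintype ι] (hι : Fintype.card ι = n) (b : ι → AdjoinRoot (X ^ n - 1 : F[X]))
    (hst : ∀ i, AdjoinRoot.root _ * b i ∈ Submodule.span F (Set.range b))
    (f g : F[X]) (hfg : IsCoprime f g)
    (hf : AdjoinRoot.mk _ f ∈ Submodule.span F (Set.range b))
    (hg : AdjoinRoot.mk _ g ∈ Submodule.span F (Set.range b)) :
    LinearIndependent F b := by
  have hq : (X ^ n - 1 : F[X]).Monic := by
    simpa using monic_X_pow_sub_C (1 : F) (n := n) (by omega)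
  set S := Submodule.span F (Set.range b)
  have h1 : ∀ y ∈ S, AdjoinRoot.root _ * y ∈ S := by
    intro y hy
    induction hy using Submodule.span_induction with
    | mem y hy => obtain ⟨i, rfl⟩ := hy; exact hst i
    | zero => simp
    | add a b _ _ h1 h2 => rw [mul_add]; exact add_mem h1 h2
    | smul a y _ h => rw [mul_smul_comm]; exact S.smul_mem _ h
  have h2 : ∀ p : F[X], ∀ y ∈ S, AdjoinRoot.mk _ p * y ∈ S := by
    intro p
    induction p using Polynomial.induction_on with
    | C a =>
      intro y hy
      have := S.smul_mem a hy
      rwa [Algebra.smul_def] at this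
    | add p q hp hq => intro y hy; rw [map_add, add_mul]; exact add_mem (hp y hy) (hq y hy)
    | monomial k a h =>
      intro y hy
      have := h _ (h1 y hy)
      rw [pow_succ, ← mul_assoc, map_mul, AdjoinRoot.mk_X, mul_assoc]
      exact this
  obtain ⟨c, e, hce⟩ := hfg
  have htop : ⊤ ≤ S := by
    intro y _
    obtain ⟨p, rfl⟩ := AdjoinRoot.mk_surjective y
    have : p = (p * c) * f + (p * e) * g := by linear_combination (-p) * hce
    rw [this, map_add, map_mul _ _ f, map_mul _ _ g]
    exact add_mem (h2 _ _ hf) (h2 _ _ hg)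
  refine linearIndependent_of_top_le_span_of_card_eq_finrank htop ?_
  rw [hι, (AdjoinRoot.powerBasis hq.ne_zero).finrank, AdjoinRoot.powerBasis_dim]
  have := natDegree_X_pow_sub_C (n := n) (r := (1 : F))
  simpa using this.symm

lemma root_pow {F : Type*} [Field F] (n : ℕ) :
   (AdjoinRoot.root (X ^ n - 1 : F[X])) ^ n = 1 := by
  have := AdjoinRoot.mk_self (f := (X ^ n - 1 : F[X]))
  rw [map_sub, map_pow, AdjoinRoot.mk_X, map_one] at this
  exact sub_eq_zero.1 this

/-- The sequence of spans. -/
noncomputable def KK {F : Type*} [Field F] (K : Submodule F F[X]) : ℕ → Submodule F F[X]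
  | 0 => K
  | (d+1) => KK K d ⊔ K.map (LinearMap.mulLeft F (X ^ (d+1)))

lemma KK_mem {F : Type*} [Field F] (K : Submodule F F[X]) (d i : ℕ) (hi : i ≤ d) (y : F[X])
    (hy : y ∈ K) : X ^ i * y ∈ KK K d := by
  induction d with
  | zero =>
    obtain rfl : i = 0 := by omega
    simpa [KK] using hy
  | succ d ih =>
    rcases Nat.lt_or_ge d i with h | h
    · obtain rfl : i = d + 1 := by omega
      exact Submodule.mem_sup_right ⟨y, hy, rfl⟩
    · exact Submodule.mem_sup_left (ih h)

lemma horner {F : Type*} [Field F] (K : Submodule F F[X]) (d : ℕ) : ∀ (c : ℕ → F) (w R : F[X]),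
    (X ^ (d+1) + ∑ i ∈ Finset.range (d+1), C (c i) * X ^ i) * w + R ∈ KK K d →
    ∃ W : ℕ → F[X], W 0 = w ∧ (∀ i < d, X * W i - W (i+1) ∈ K) ∧
      X * W d + ∑ i ∈ Finset.range (d+1), C (c i) * W i + R ∈ K := by
  induction d with
  | zero =>
    intro c w R h
    refine ⟨fun _ => w, rfl, by simp, ?_⟩
    simp [KK] at h ⊢
    convert h using 1; ring
  | succ d ih =>
    intro c w R h
    obtain ⟨a, ha, _, ⟨y, hy, rfl⟩, hay⟩ := Submodule.mem_sup.1 h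
    simp only [LinearMap.mulLeft_apply] at hay
    obtain ⟨W, h0, h1, h2⟩ := ih (fun i => c (i+1)) (X * w - y) (R + C (c 0) * w) (by
      have h3 : (∑ i ∈ Finset.range (d+1), C (c (i+1)) * X ^ i) * y ∈ KK K d := by
        rw [Finset.sum_mul]
        refine Submodule.sum_mem _ fun i hi => ?_
        rw [mul_assoc, ← Polynomial.smul_eq_C_mul]
        exact Submodule.smul_mem _ _ (KK_mem K d i (by simp at hi; omega) y hy)
      have := sub_mem ha h3
      convert this using 1
      rw [Finset.sum_range_succ'] at hay
      have e : ∑ i ∈ Finset.range (d+1), C (c (i+1)) * X ^ (i+1)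
        = X * ∑ i ∈ Finset.range (d+1), C (c (i+1)) * X ^ i := by
        rw [Finset.mul_sum]; refine Finset.sum_congr rfl fun i _ => by ring
      rw [e] at hay
      linear_combination -hay)
    refine ⟨fun i => if i = 0 then w else W (i - 1), by simp, ?_, ?_⟩
    · intro i hi
      rcases i with _ | i
      · simpa [h0] using hy
      · simpa using h1 i (by omega)
    · rw [Finset.sum_range_succ']
      simp only [Nat.add_eq_zero_iff, one_ne_zero, and_false, if_false, if_true, Nat.add_sub_cancel]
      convert h2 using 1; ring

lemma spanZ {F : Type*} [Field F] (d : ℕ) (hd : 1 ≤ d) (k : ℕ) : ∀ (S : Submodule F F[X]),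
    (∀ i ≤ d, ∀ l ≤ k, X ^ i * (X ^ (2 * l) * (X + 1) ^ (k - l)) ∈ S) →
    ∀ f : F[X], f.natDegree ≤ 2 * k + d → f ∈ S := by
  induction k with
  | zero =>
    intro S hS f hf
    rw [f.as_sum_range_C_mul_X_pow]
    refine Submodule.sum_mem _ fun i hi => ?_
    rw [← Polynomial.smul_eq_C_mul]
    refine Submodule.smul_mem _ _ ?_
    simpa using hS i (by simp at hi; omega) 0 le_rfl
  | succ k ih =>
    intro S hS f hf
    have hco : IsCoprime ((X + 1 : F[X]) ^ (k+1)) (X ^ 2) := by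
      apply IsCoprime.pow
      exact ⟨1, -1, by ring⟩
    obtain ⟨c, e, hce⟩ := hco
    have hm : (X ^ 2 : F[X]).Monic := monic_X_pow 2
    have hg := Polynomial.modByMonic_add_div (f * c) (X ^ 2)
    set g := (f * c) %ₘ (X ^ 2) with hgdef
    have hgd : g.natDegree ≤ 1 := by
      have : g.natDegree < (X ^ 2 : F[X]).natDegree := 
        Polynomial.natDegree_modByMonic_lt _ hm (by
          intro h; have := congrArg natDegree h; simp at this)
      simp at this; omega
    set f' := f * e + ((f * c) /ₘ X ^ 2) * (X + 1) ^ (k+1) with hf'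
    have hdec : f = g * (X + 1) ^ (k + 1) + X ^ 2 * f' := by
      rw [hf']; linear_combination (-f) * hce - (X + 1) ^ (k+1) * hg
    have hfd : f'.natDegree ≤ 2 * k + d := by
      by_cases h0 : f' = 0
      · simp [h0]
      have e1 : (X ^ 2 * f').natDegree = 2 + f'.natDegree := by
        rw [hm.natDegree_mul' h0]; simp
      have e2 : X ^ 2 * f' = f - g * (X + 1) ^ (k+1) := by linear_combination -hdec
      have e3 : (f - g * (X + 1) ^ (k+1)).natDegree ≤ 2 * (k+1) + d := by
        refine (natDegree_sub_le _ _).trans (max_le hf ?_)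
        refine natDegree_mul_le.trans ?_
        have : ((X + 1 : F[X]) ^ (k+1)).natDegree ≤ k+1 := by
          compute_degree
        omega
      rw [← e2, e1] at e3
      omega
    rw [hdec]
    refine add_mem ?_ ?_
    · rw [g.as_sum_range_C_mul_X_pow, Finset.sum_mul]
      refine Submodule.sum_mem _ fun i hi => ?_
      rw [← Polynomial.smul_eq_C_mul, smul_mul_assoc]
      refine Submodule.smul_mem _ _ ?_
      simpa using hS i (by simp at hi; omega) 0 (by omega)
    · refine ih (S.comap (LinearMap.mulLeft F (X ^ 2))) ?_ f' hfd
      intro i hi l hl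
      have := hS i hi (l+1) (by omega)
      rw [Submodule.mem_comap, LinearMap.mulLeft_apply]
      convert this using 1
      rw [show k + 1 - (l + 1) = k - l by omega]
      ring

lemma exists_completion {F : Type*} [Field F] (k d : ℕ) (hd : 1 ≤ d) (c : ℕ → F)
    (hc : c (k + d) = 0) :
    ∃ (φ : Matrix (Fin (k+1)) (Fin (k + 1 + d)) F) (ρ : Matrix (Fin (k + 1 + d)) (Fin (k+1)) F),
      (fromBlocks 0 φ ρ (compMat F (k + 1 + d) c)) ^ (2 * k + 2 + d) = 1 := by
  set n := 2 * k + 2 + d with hn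
  set m := k + 1 + d with hm
  let z : ℕ → F[X] := fun l => X ^ (2 * l) * (X + 1) ^ (k - l)
  let K : Submodule F F[X] := Submodule.span F (Set.range fun l : Fin (k+1) => z l)
  have hzK : ∀ l ≤ k, z l ∈ K := fun l hl => Submodule.subset_span ⟨⟨l, by omega⟩, rfl⟩
  have hzd : ∀ l ≤ k, (z l).natDegree ≤ k + l := by
    intro l hl
    refine natDegree_mul_le.trans ?_
    have : ((X + 1 : F[X]) ^ (k - l)).natDegree ≤ k - l := by compute_degree
    have h2 : (X ^ (2 * l) : F[X]).natDegree = 2 * l := natDegree_X_pow _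
    omega
  obtain ⟨W, h0, h1, h2⟩ := horner K d (fun i => c (k + i)) (X * z k)
    (∑ i ∈ Finset.range k, C (c i) * (X * z i) - (X ^ n - 1)) (by
      refine spanZ d hd k (KK K d) (fun i hi l hl => KK_mem K d i hi _ (hzK l hl)) _ ?_
      have e : (X ^ (d+1) + ∑ i ∈ Finset.range (d+1), C (c (k+i)) * X ^ i) * (X * z k)
          + (∑ i ∈ Finset.range k, C (c i) * (X * z i) - (X ^ n - 1))
          = ∑ i ∈ Finset.range d, C (c (k+i)) * X ^ (i + 2 * k + 1)
          + (∑ i ∈ Finset.range k, C (c i) * (X * z i) + 1) := by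
        rw [Finset.sum_range_succ, hc]
        have : ∑ i ∈ Finset.range d, C (c (k+i)) * X ^ (i + 2 * k + 1)
          = (∑ i ∈ Finset.range d, C (c (k+i)) * X ^ i) * X ^ (2 * k + 1) := by
          rw [Finset.sum_mul]; refine Finset.sum_congr rfl fun i _ => by ring
        rw [this, hn]
        simp only [z, Nat.sub_self, map_zero]
        ring
      rw [e]
      refine natDegree_add_le_of_degree_le ?_ (natDegree_add_le_of_degree_le ?_ (by simp))
      · refine natDegree_sum_le_of_forall_le _ _ fun i hi => ?_
        refine (natDegree_C_mul_X_pow_le _ _).trans ?_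
        simp at hi; omega
      · refine natDegree_sum_le_of_forall_le _ _ fun i hi => ?_
        refine (natDegree_C_mul_le _ _).trans (natDegree_mul_le.trans ?_)
        simp at hi
        have := hzd i (by omega)
        rw [natDegree_X]; omega)
  let w : ℕ → F[X] := fun i => if i < k then X * z i else W (i - k)
  have hwz : ∀ i ≤ k, w i = X * z i := by
    intro i hi
    by_cases h : i < k
    · simp [w, h]
    · obtain rfl : i = k := by omega
      simp [w, h0]
  have hw1 : ∀ i, i + 1 < m → X * w i - w (i+1) ∈ K := by
    intro i hi
    by_cases h : i < k
    · rw [hwz i (by omega), hwz (i+1) (by omega)]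
      have := hzK (i+1) (by omega)
      convert this using 1
      simp only [z]
      rw [show k - i = k - (i+1) + 1 by omega]
      ring
    · have := h1 (i - k) (by omega)
      simp only [w, h, if_false, show ¬ (i + 1 < k) by omega]
      rwa [show i + 1 - k = i - k + 1 by omega]
  have hw2 : X * w (k + d) + ∑ j ∈ Finset.range m, c j • w j - (X ^ n - 1) ∈ K := by
    convert h2 using 1
    rw [hm, add_assoc k 1 d, Finset.sum_range_add, add_comm 1 d]
    have e1 : ∑ j ∈ Finset.range k, c j • w j = ∑ i ∈ Finset.range k, C (c i) * (X * z i) := by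
      refine Finset.sum_congr rfl fun i hi => ?_
      rw [hwz i (by simp at hi; omega), Polynomial.smul_eq_C_mul]
    have e2 : ∀ i, w (k + i) = W i := by intro i; simp [w]
    rw [e1]
    simp only [e2, Polynomial.smul_eq_C_mul]
    ring
  let mk := AdjoinRoot.mkₐ (R := F) (X ^ n - 1 : F[X])
  have hmkq : mk (X ^ n - 1) = 0 := AdjoinRoot.mk_self
  have hmkX : mk X = AdjoinRoot.root _ := AdjoinRoot.mk_X
  have key : ∀ i : Fin m, ∃ a : Fin (k+1) → F,
      AdjoinRoot.root _ * mk (w i) = ∑ l, a l • mk (z l) + ∑ j, compMat F m c j i • mk (w j) := by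
    intro i
    rw [sum_compMat m c (fun j => mk (w j)) i]
    split_ifs with hi
    · obtain ⟨a, ha⟩ := (Submodule.mem_span_range_iff_exists_fun F).1 (hw1 i hi)
      refine ⟨a, ?_⟩
      have := congrArg mk ha
      simp only [map_sum, map_smul, map_sub, map_mul, hmkX] at this
      rw [this]; ring
    · have hi' : (i : ℕ) = k + d := by omega
      obtain ⟨a, ha⟩ := (Submodule.mem_span_range_iff_exists_fun F).1 hw2
      refine ⟨a, ?_⟩
      have := congrArg mk ha
      rw [map_sub, hmkq] at this
      simp only [map_sum, map_smul, map_add, map_mul, hmkX] at this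
      rw [this, hi']; ring
  choose a ha using key
  let ρ : Matrix (Fin m) (Fin (k+1)) F := Matrix.of fun j l => if (j : ℕ) = l then 1 else 0
  let b : Fin (k+1) ⊕ Fin m → AdjoinRoot (X ^ n - 1 : F[X]) :=
    Sum.elim (fun l => mk (z l)) (fun j => mk (w j))
  refine ⟨Matrix.of fun l i => a i l, ρ, ?_⟩
  have hT : ∀ i, AdjoinRoot.root _ * b i = ∑ j, (fromBlocks 0 (Matrix.of fun l i => a i l) ρ (compMat F m c)) j i • b j := by
    rintro (l | i)
    · rw [Fintype.sum_sum_type]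
      simp only [fromBlocks_apply₁₁, fromBlocks_apply₂₁, Matrix.zero_apply, zero_smul, Finset.sum_const_zero, zero_add, b, Sum.elim_inl, Sum.elim_inr]
      rw [Finset.sum_eq_single (⟨l, by omega⟩ : Fin m)]
      · simp [ρ, hwz l (by omega), hmkX]
      · intro j _ hj
        have : (j : ℕ) ≠ l := fun h => hj (Fin.ext h)
        simp [ρ, this]
      · simp
    · rw [Fintype.sum_sum_type]
      simpa [b] using ha i
  refine pow_eq_one_of_basis b ?_ _ _ hT n (root_pow n)
  refine linIndep_of_stable (by omega) (by simp; omega) b (fun i => ?_) (z 0) (z k) ?_ ?_ ?_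
  · rw [hT]
    exact Submodule.sum_mem _ fun j _ => Submodule.smul_mem _ _ (Submodule.subset_span ⟨j, rfl⟩)
  · have : IsCoprime (X + 1 : F[X]) X := ⟨1, -1, by ring⟩
    simpa [z] using this.pow
  · exact Submodule.subset_span ⟨Sum.inl ⟨0, by omega⟩, rfl⟩
  · exact Submodule.subset_span ⟨Sum.inl ⟨k, by omega⟩, rfl⟩

lemma comp_cyclic {F : Type*} [Field F] (n : ℕ) (hn : 2 ≤ n) :
    (compMat F n (fun j => if j = 0 then -1 else 0)) ^ n = 1 := by
  have hT : ∀ i : Fin n, AdjoinRoot.root (X ^ n - 1 : F[X]) * AdjoinRoot.root (X ^ n - 1 : F[X]) ^ (i : ℕ)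
    = ∑ j : Fin n, compMat F n (fun j => if j = 0 then -1 else 0) j i • AdjoinRoot.root (X ^ n - 1 : F[X]) ^ (j : ℕ) := by
    intro i
    rw [sum_compMat n _ (fun j => AdjoinRoot.root (X ^ n - 1 : F[X]) ^ j) i, ← pow_succ']
    split_ifs with h
    · rfl
    · rw [show (i : ℕ) + 1 = n by omega, root_pow]
      simp [ite_smul, show 0 < n by omega]
  refine pow_eq_one_of_basis _ ?_ _ _ hT n (root_pow n)
  refine linIndep_of_stable hn (by simp) _ (fun i => ?_) 1 1 isCoprime_one_left ?_ ?_
  · rw [hT]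
    exact Submodule.sum_mem _ fun j _ => Submodule.smul_mem _ _ (Submodule.subset_span ⟨j, rfl⟩)
  · exact Submodule.subset_span ⟨⟨0, by omega⟩, by simp⟩
  · exact Submodule.subset_span ⟨⟨0, by omega⟩, by simp⟩

lemma conj_finish {F : Type*} [Field F] {ι : Type*} [Fintype ι] [DecidableEq ι] (n : ℕ)
    (A S T N : Matrix ι ι F) (hS : IsUnit S) (h : A * S = S * (T + N)) (hT : T ^ n = 1)
    (hN : N ^ 2 = 0) : ∃ T N₂ : Matrix ι ι F, T ^ n = 1 ∧ N₂ ^ 2 = 0 ∧ A = T + N₂ := by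
  obtain ⟨u, rfl⟩ := hS
  refine ⟨u * T * (u⁻¹ : (Matrix ι ι F)ˣ), u * N * (u⁻¹ : (Matrix ι ι F)ˣ), ?_, ?_, ?_⟩
  · rw [Units.conj_pow, hT]; simp
  · rw [Units.conj_pow, hN]; simp
  · rw [← add_mul, ← mul_add, ← h, Units.mul_inv_cancel_right]

theorem torsion_plus_squareZero
    (F : Type*) [Field F] (n k : ℕ) (hn : 2 ≤ n) (hk : k < n - k)
    (A₂₂ : Matrix (Fin (n - k)) (Fin (n - k)) F)
    (hInv : IsUnit A₂₂)
    (hNonDerog : minpoly F A₂₂ = A₂₂.charpoly)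
    (A : Matrix (Fin k ⊕ Fin (n - k)) (Fin k ⊕ Fin (n - k)) F)
    (hA : A = Matrix.fromBlocks 0 0 0 A₂₂)
    (htr : A.trace = 0) :
    ∃ T N₂ : Matrix (Fin k ⊕ Fin (n - k)) (Fin k ⊕ Fin (n - k)) F,
      T ^ n = 1 ∧ N₂ ^ 2 = 0 ∧ A = T + N₂ := by
  obtain ⟨P, hP, hPC⟩ := exists_cyclic (n - k) A₂₂ hNonDerog
  have htr2 : A₂₂.trace = 0 := by
    rw [hA] at htr
    simpa [Matrix.trace, Fintype.sum_sum_type] using htr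
  have hcoef : A₂₂.charpoly.coeff (n - k - 1) = 0 := by
    have : Nonempty (Fin (n - k)) := ⟨⟨0, by omega⟩⟩
    have := Matrix.trace_eq_neg_charpoly_coeff A₂₂
    rw [htr2, Fintype.card_fin] at this
    simpa using this.symm
  obtain ⟨c, hc⟩ : ∃ c, c = A₂₂.charpoly.coeff := ⟨_, rfl⟩
  rw [← hc] at hcoef hPC
  have hPd := (Matrix.isUnit_iff_isUnit_det _).1 hP
  rcases k with _ | k
  · have hN : (compMat F (n - 0) c - compMat F (n - 0) (fun j => if j = 0 then -1 else 0)) ^ 2 = 0 := by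
      ext a i
      rw [pow_two, Matrix.mul_apply]
      refine Finset.sum_eq_zero fun j _ => ?_
      by_cases hj : (j : ℕ) + 1 < n
      · simp [compMat, hj]
      · have hj' : (j : ℕ) = n - 1 := by omega
        have hj'' : n - 1 ≠ 0 := by omega
        have : c (n - 1) = 0 := by simpa using hcoef
        have e : ¬ (n - 1 + 1 < n) := by omega
        simp [compMat, hj', this, hj'']
    refine conj_finish n A (fromBlocks 1 0 0 P)
      (fromBlocks 1 0 0 (compMat F (n - 0) (fun j => if j = 0 then -1 else 0)))
      (fromBlocks 0 0 0 (compMat F (n - 0) c - compMat F (n - 0) (fun j => if j = 0 then -1 else 0))) ?_ ?_ ?_ ?_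
    · rw [Matrix.isUnit_iff_isUnit_det]
      simpa using hPd
    · rw [hA, fromBlocks_add, fromBlocks_multiply, fromBlocks_multiply]
      simp [hPC]
      exact Subsingleton.elim _ _
    · rw [Matrix.fromBlocks_diagonal_pow]
      have h := comp_cyclic (F := F) n hn
      simp only [Nat.sub_zero]
      rw [h]
      simp
    · rw [Matrix.fromBlocks_diagonal_pow, hN]
      simp
  · obtain ⟨d, hd⟩ : ∃ d, n = 2 * k + 2 + d := ⟨n - (2 * k + 2), by omega⟩
    have hm : n - (k + 1) = k + 1 + d := by omega
    have hC : IsUnit (compMat F (n - (k + 1)) c).det := by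
      have h1 := congrArg Matrix.det hPC
      rw [det_mul, det_mul] at h1
      have h2 : IsUnit (P.det * (compMat F (n - (k + 1)) c).det) := by
        rw [← h1]; exact ((Matrix.isUnit_iff_isUnit_det _).1 hInv).mul hPd
      exact isUnit_of_mul_isUnit_right h2
    obtain ⟨φ, ρ, hT⟩ : ∃ (φ : Matrix (Fin (k+1)) (Fin (n - (k + 1))) F)
        (ρ : Matrix (Fin (n - (k + 1))) (Fin (k+1)) F),
        (fromBlocks 0 φ ρ (compMat F (n - (k + 1)) c)) ^ n = 1 := by
      have h := exists_completion k d (by omega) c (by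
        rw [← hcoef]; congr 1; omega)
      rw [hm, hd]
      exact h
    refine conj_finish n A (fromBlocks 1 (-φ * (compMat F (n - (k + 1)) c)⁻¹) 0 P) _
      (fromBlocks 0 0 (-ρ) 0) ?_ ?_ hT ?_
    · rw [Matrix.isUnit_iff_isUnit_det]
      simpa using hPd
    · rw [hA, fromBlocks_add, fromBlocks_multiply, fromBlocks_multiply]
      simp [hPC, Matrix.nonsing_inv_mul_cancel_right _ _ hC]
    · rw [pow_two, fromBlocks_multiply]
      simp
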